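/- Let C be a unital b-category with induced braiding c, and define the associator α_{X,Y,Z} := c_{Z,X⊗Y} ∘ β_{Z,X,Y}^{-1} ∘ (1_X ⊗ c_{Z,Y}^{-1}) : X⊗(Y⊗Z) → (X⊗Y)⊗Z. Then both hexagon axioms of a braided monoidal category hold: for all objects X, Y, Z, (i) α_{Z,X,Y} ∘ c_{X⊗Y,Z} ∘ α_{X,Y,Z} = (c_{X,Z} ⊗ 1_Y) ∘ α_{X,Z,Y} ∘ (1_X ⊗ c_{Y,Z}) as morphisms X⊗(Y⊗Z) → (Z⊗X)⊗Y, and (ii) α_{Y,Z,X}^{-1} ∘ c_{X,Y⊗Z} ∘ α_{X,Y,Z}^{-1} = (1_Y ⊗ c_{X,Z}) ∘ α_{Y,X,Z}^{-1} ∘ (c_{X,Y} ⊗ 1_Z) as morphisms (X⊗Y)⊗Z → Y⊗(Z⊗X). -/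

import Mathlib

open CategoryTheory

universe v u

/-- A b-category: a category with a tensor product functor `⊗ : C × C → C` and a
natural family of isomorphisms `β_{X,Y,Z} : X⊗(Y⊗Z) ≅ Y⊗(X⊗Z)` satisfying the
permutohedron coherence. -/
structure BCat (C : Type u) [Category.{v} C] where
  tensorObj : C → C → C
  tensorHom : ∀ {X₁ Y₁ X₂ Y₂ : C}, (X₁ ⟶ Y₁) → (X₂ ⟶ Y₂) →
    (tensorObj X₁ X₂ ⟶ tensorObj Y₁ Y₂)
  tensorHom_id : ∀ (X Y : C), tensorHom (𝟙 X) (𝟙 Y) = 𝟙 (tensorObj X Y)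
  tensorHom_comp : ∀ {X₁ Y₁ Z₁ X₂ Y₂ Z₂ : C} (f₁ : X₁ ⟶ Y₁) (g₁ : Y₁ ⟶ Z₁)
    (f₂ : X₂ ⟶ Y₂) (g₂ : Y₂ ⟶ Z₂),
    tensorHom (f₁ ≫ g₁) (f₂ ≫ g₂) = tensorHom f₁ f₂ ≫ tensorHom g₁ g₂
  β : ∀ (X Y Z : C), tensorObj X (tensorObj Y Z) ≅ tensorObj Y (tensorObj X Z)
  β_natural : ∀ {X₁ Y₁ X₂ Y₂ X₃ Y₃ : C} (f : X₁ ⟶ Y₁) (g : X₂ ⟶ Y₂) (h : X₃ ⟶ Y₃),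
    tensorHom f (tensorHom g h) ≫ (β Y₁ Y₂ Y₃).hom
      = (β X₁ X₂ X₃).hom ≫ tensorHom g (tensorHom f h)
  b_coherence : ∀ (X Y Z W : C),
    tensorHom (𝟙 X) (β Y Z W).hom ≫ (β X Z (tensorObj Y W)).hom
        ≫ tensorHom (𝟙 Z) (β X Y W).hom
      = (β X Y (tensorObj Z W)).hom ≫ tensorHom (𝟙 Y) (β X Z W).hom
        ≫ (β Y Z (tensorObj X W)).hom

/-- A unital b-category: a b-category with a unit object `I` and a natural family
of isomorphisms `ρ_X : X ⊗ I ≅ X`, required (below) to satisfy the unit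
coherence `UnitCoh` and the mixed coherence `MixedCoh`. -/
structure UBCat (C : Type u) [Category.{v} C] extends BCat C where
  unit : C
  ρ : ∀ X : C, tensorObj X unit ≅ X
  ρ_natural : ∀ {X Y : C} (f : X ⟶ Y),
    tensorHom f (𝟙 unit) ≫ (ρ Y).hom = (ρ X).hom ≫ f

variable {C : Type u} [Category.{v} C]

/-- Tensoring an isomorphism with an identity on the left, as an isomorphism. -/
def UBCat.idTensor (B : UBCat C) (X : C) {Y Y' : C} (e : Y ≅ Y') :
    B.tensorObj X Y ≅ B.tensorObj X Y' where
  hom := B.tensorHom (𝟙 X) e.hom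
  inv := B.tensorHom (𝟙 X) e.inv
  hom_inv_id := by rw [← B.tensorHom_comp]; simp [B.tensorHom_id]
  inv_hom_id := by rw [← B.tensorHom_comp]; simp [B.tensorHom_id]

/-- The induced braiding `c_{X,Y} = (1_Y ⊗ ρ_X) ∘ β_{X,Y,I} ∘ (1_X ⊗ ρ_Y⁻¹)`
of a unital b-category. -/
def UBCat.c (B : UBCat C) (X Y : C) : B.tensorObj X Y ≅ B.tensorObj Y X :=
  B.idTensor X (B.ρ Y).symm ≪≫ B.β X Y B.unit ≪≫ B.idTensor Y (B.ρ X)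

/-- The unit coherence of a unital b-category:
`c_{X⊗Y,I} ∘ ρ_{X⊗Y}⁻¹ = β_{X,I,Y} ∘ (1_X ⊗ c_{Y,I}) ∘ (1_X ⊗ ρ_Y⁻¹)`. -/
def UBCat.UnitCoh (B : UBCat C) : Prop :=
  ∀ X Y : C,
    (B.ρ (B.tensorObj X Y)).inv ≫ (B.c (B.tensorObj X Y) B.unit).hom
      = B.tensorHom (𝟙 X) (B.ρ Y).inv ≫ B.tensorHom (𝟙 X) (B.c Y B.unit).hom
          ≫ (B.β X B.unit Y).hom

/-- The mixed coherence of a unital b-category: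
`(1_X ⊗ c_{Z⊗W,Y}) ∘ β_{Z⊗W,X,Y} ∘ c_{X⊗Y,Z⊗W}
  = (1_X ⊗ β_{Z,Y,W}) ∘ (1_X ⊗ (1_Z ⊗ c_{W,Y})) ∘ β_{Z,X,W⊗Y} ∘ (1_Z ⊗ β_{W,X,Y})
      ∘ (1_Z ⊗ c_{X⊗Y,W}) ∘ β_{X⊗Y,Z,W}`. -/
def UBCat.MixedCoh (B : UBCat C) : Prop :=
  ∀ X Y Z W : C,
    (B.c (B.tensorObj X Y) (B.tensorObj Z W)).hom ≫ (B.β (B.tensorObj Z W) X Y).hom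
        ≫ B.tensorHom (𝟙 X) (B.c (B.tensorObj Z W) Y).hom
      = (B.β (B.tensorObj X Y) Z W).hom
          ≫ B.tensorHom (𝟙 Z) (B.c (B.tensorObj X Y) W).hom
          ≫ B.tensorHom (𝟙 Z) (B.β W X Y).hom
          ≫ (B.β Z X (B.tensorObj W Y)).hom
          ≫ B.tensorHom (𝟙 X) (B.tensorHom (𝟙 Z) (B.c W Y).hom)
          ≫ B.tensorHom (𝟙 X) (B.β Z Y W).hom

namespace UBCat

variable (B : UBCat C)

lemma id_tensor_comp (X : C) {Y Y' Y'' : C} (f : Y ⟶ Y') (g : Y' ⟶ Y'') :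
    B.tensorHom (𝟙 X) (f ≫ g) = B.tensorHom (𝟙 X) f ≫ B.tensorHom (𝟙 X) g := by
  rw [← B.tensorHom_comp, Category.comp_id]

lemma id_tensor_hom_inv (X : C) {Y Y' : C} (e : Y ≅ Y') :
    B.tensorHom (𝟙 X) e.hom ≫ B.tensorHom (𝟙 X) e.inv = 𝟙 _ :=
  (B.idTensor X e).hom_inv_id

lemma id_tensor_inv_hom (X : C) {Y Y' : C} (e : Y ≅ Y') :
    B.tensorHom (𝟙 X) e.inv ≫ B.tensorHom (𝟙 X) e.hom = 𝟙 _ :=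
  (B.idTensor X e).inv_hom_id

lemma tensorHom_exchange {X X' Y Y' : C} (f : X ⟶ X') (g : Y ⟶ Y') :
    B.tensorHom f (𝟙 Y) ≫ B.tensorHom (𝟙 X') g =
      B.tensorHom (𝟙 X) g ≫ B.tensorHom f (𝟙 Y') := by
  simp only [← B.tensorHom_comp, Category.comp_id, Category.id_comp]

lemma c_hom (X Y : C) :
    (B.c X Y).hom =
      B.tensorHom (𝟙 X) (B.ρ Y).inv ≫ (B.β X Y B.unit).hom ≫ B.tensorHom (𝟙 Y) (B.ρ X).hom :=
  rfl

lemma ρ_inv_natural {X Y : C} (f : X ⟶ Y) :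
    f ≫ (B.ρ Y).inv = (B.ρ X).inv ≫ B.tensorHom f (𝟙 B.unit) := by
  rw [Iso.comp_inv_eq, Category.assoc, B.ρ_natural, Iso.inv_hom_id_assoc]

lemma c_natural {X X' Y Y' : C} (f : X ⟶ X') (g : Y ⟶ Y') :
    B.tensorHom f g ≫ (B.c X' Y').hom = (B.c X Y).hom ≫ B.tensorHom g f := by
  have h₁ : B.tensorHom f g ≫ B.tensorHom (𝟙 X') (B.ρ Y').inv =
      B.tensorHom (𝟙 X) (B.ρ Y).inv ≫ B.tensorHom f (B.tensorHom g (𝟙 B.unit)) := by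
    rw [← B.tensorHom_comp, ← B.tensorHom_comp, ρ_inv_natural, Category.comp_id, Category.id_comp]
  have h₂ : B.tensorHom g (B.tensorHom f (𝟙 B.unit)) ≫ B.tensorHom (𝟙 Y') (B.ρ X').hom =
      B.tensorHom (𝟙 Y) (B.ρ X).hom ≫ B.tensorHom g f := by
    rw [← B.tensorHom_comp, ← B.tensorHom_comp, B.ρ_natural, Category.comp_id, Category.id_comp]
  rw [c_hom, c_hom, reassoc_of% h₁, reassoc_of% B.β_natural, h₂]
  simp only [Category.assoc]

lemma c_inv_natural {X X' Y Y' : C} (f : X ⟶ X') (g : Y ⟶ Y') :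
    B.tensorHom g f ≫ (B.c X' Y').inv = (B.c X Y).inv ≫ B.tensorHom f g := by
  rw [Iso.comp_inv_eq, Category.assoc, c_natural, Iso.inv_hom_id_assoc]

lemma β_unit_hom (X Y : C) :
    (B.β X Y B.unit).hom =
      B.tensorHom (𝟙 X) (B.ρ Y).hom ≫ (B.c X Y).hom ≫ B.tensorHom (𝟙 Y) (B.ρ X).inv := by
  rw [c_hom]
  simp only [Category.assoc, id_tensor_hom_inv, Category.comp_id]
  rw [reassoc_of% B.id_tensor_hom_inv]

/-- The permutohedron coherence with its last object the unit, in terms of the braiding. -/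
lemma β_c_coherence (X Y Z : C) :
    B.tensorHom (𝟙 X) (B.c Y Z).hom ≫ (B.β X Z Y).hom ≫ B.tensorHom (𝟙 Z) (B.c X Y).hom =
      (B.β X Y Z).hom ≫ B.tensorHom (𝟙 Y) (B.c X Z).hom ≫ (B.β Y Z X).hom := by
  have h := B.b_coherence X Y Z B.unit
  simp only [β_unit_hom, id_tensor_comp, Category.assoc] at h
  have n (X Y Z : C) := B.β_natural (𝟙 X) (𝟙 Y) (B.ρ Z).hom
  have n' (X Y Z : C) := B.β_natural (𝟙 X) (𝟙 Y) (B.ρ Z).inv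
  rw [reassoc_of% n', ← reassoc_of% n, n'] at h
  have e (X Y Z : C) : B.tensorHom (𝟙 X) (B.tensorHom (𝟙 Y) (B.ρ Z).inv) ≫
      B.tensorHom (𝟙 X) (B.tensorHom (𝟙 Y) (B.ρ Z).hom) = 𝟙 _ :=
    B.id_tensor_inv_hom X (B.idTensor Y (B.ρ Z))
  rw [reassoc_of% e] at h
  have h' := congrArg (fun f => B.tensorHom (𝟙 X) (B.tensorHom (𝟙 Y) (B.ρ Z).inv) ≫ f ≫
    B.tensorHom (𝟙 Z) (B.tensorHom (𝟙 Y) (B.ρ X).hom)) h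
  simpa only [Category.assoc, reassoc_of% e, e, Category.comp_id] using h'

/-- The double braiding of `X` with `Z ⊗ W` decomposes through that of `X` with `W`. -/
lemma c_hom_comp_c_hom {B : UBCat C} (h₁ : B.UnitCoh) (h₂ : B.MixedCoh) (X Z W : C) :
    (B.c X (B.tensorObj Z W)).hom ≫ (B.c (B.tensorObj Z W) X).hom =
      (B.β X Z W).hom ≫ B.tensorHom (𝟙 Z) (B.c X W).hom ≫ B.tensorHom (𝟙 Z) (B.c W X).hom ≫
        (B.β Z X W).hom := by
  have h := h₂ X B.unit Z W
  simp only [β_unit_hom, id_tensor_comp, Category.assoc] at h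
  have hu : B.tensorHom (𝟙 Z) (B.ρ W).inv ≫ B.tensorHom (𝟙 Z) (B.c W B.unit).hom ≫
      (B.β Z B.unit W).hom = ((B.ρ (B.tensorObj Z W)).symm ≪≫ B.c (B.tensorObj Z W) B.unit).hom :=
    (h₁ Z W).symm
  have hc (A : C) : B.tensorHom (𝟙 A) (B.ρ X).hom ≫ (B.c A X).hom =
      (B.c A (B.tensorObj X B.unit)).hom ≫ B.tensorHom (B.ρ X).hom (𝟙 A) := B.c_natural _ _
  have hc' (A : C) : (B.c (B.tensorObj X B.unit) A).hom ≫ B.tensorHom (𝟙 A) (B.ρ X).hom =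
      B.tensorHom (B.ρ X).hom (𝟙 A) ≫ (B.c X A).hom := (B.c_natural _ _).symm
  have hz : B.tensorHom (𝟙 Z) (B.c (B.tensorObj X B.unit) W).hom ≫
      B.tensorHom (𝟙 Z) (B.tensorHom (𝟙 W) (B.ρ X).hom) =
      B.tensorHom (𝟙 Z) (B.tensorHom (B.ρ X).hom (𝟙 W)) ≫ B.tensorHom (𝟙 Z) (B.c X W).hom := by
    rw [← id_tensor_comp, hc', id_tensor_comp]
  have hβ := B.β_natural (B.ρ X).hom (𝟙 Z) (𝟙 W)
  rw [B.tensorHom_id] at hβ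
  rw [reassoc_of% hc', reassoc_of% hz, ← reassoc_of% hβ,
    reassoc_of% (B.β_natural (𝟙 Z) (𝟙 X) (B.ρ W).inv)] at h
  simp only [← id_tensor_comp] at h
  rw [hu, Iso.trans_hom, Iso.symm_hom] at h
  have i₁ : B.tensorHom (B.ρ X).inv (𝟙 (B.tensorObj Z W)) ≫
      B.tensorHom (B.ρ X).hom (𝟙 (B.tensorObj Z W)) = 𝟙 _ := by
    rw [← B.tensorHom_comp, Iso.inv_hom_id, Category.comp_id, B.tensorHom_id]
  have h' := congrArg (fun f => B.tensorHom (B.ρ X).inv (𝟙 (B.tensorObj Z W)) ≫ f ≫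
    B.tensorHom (𝟙 X)
      ((B.ρ (B.tensorObj Z W)).symm ≪≫ B.c (B.tensorObj Z W) B.unit).inv) h
  have i₂ := B.id_tensor_hom_inv X ((B.ρ (B.tensorObj Z W)).symm ≪≫ B.c (B.tensorObj Z W) B.unit)
  rw [Iso.trans_hom, Iso.symm_hom, id_tensor_comp, Category.assoc] at i₂
  simpa only [Category.assoc, reassoc_of% i₁, i₂, Category.comp_id, id_tensor_comp] using h'

end UBCat

/-- in a unital b-category, with the associator isomorphism `a`
whose hom-part is `α_{X,Y,Z} = c_{Z,X⊗Y} ∘ β_{Z,X,Y}⁻¹ ∘ (1_X ⊗ c_{Z,Y}⁻¹)`,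
both hexagon axioms of a braided monoidal category hold:
(i)  `α_{Z,X,Y} ∘ c_{X⊗Y,Z} ∘ α_{X,Y,Z} = (c_{X,Z} ⊗ 1_Y) ∘ α_{X,Z,Y} ∘ (1_X ⊗ c_{Y,Z})`;
(ii) `α_{Y,Z,X}⁻¹ ∘ c_{X,Y⊗Z} ∘ α_{X,Y,Z}⁻¹ = (1_Y ⊗ c_{X,Z}) ∘ α_{Y,X,Z}⁻¹ ∘ (c_{X,Y} ⊗ 1_Z)`. -/
theorem ubcat_hexagon_axioms (B : UBCat C) (h₁ : B.UnitCoh) (h₂ : B.MixedCoh)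
    (a : ∀ X Y Z : C,
      B.tensorObj X (B.tensorObj Y Z) ≅ B.tensorObj (B.tensorObj X Y) Z)
    (ha : ∀ X Y Z : C,
      (a X Y Z).hom = B.tensorHom (𝟙 X) (B.c Z Y).inv ≫ (B.β Z X Y).inv
        ≫ (B.c Z (B.tensorObj X Y)).hom)
    (X Y Z : C) :
    ((a X Y Z).hom ≫ (B.c (B.tensorObj X Y) Z).hom ≫ (a Z X Y).hom
        = B.tensorHom (𝟙 X) (B.c Y Z).hom ≫ (a X Z Y).hom
            ≫ B.tensorHom (B.c X Z).hom (𝟙 Y)) ∧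
    ((a X Y Z).inv ≫ (B.c X (B.tensorObj Y Z)).hom ≫ (a Y Z X).inv
        = B.tensorHom (B.c X Y).hom (𝟙 Z) ≫ (a Y X Z).inv
            ≫ B.tensorHom (𝟙 Y) (B.c X Z).hom) := by
  have hi (X Y Z : C) : (a X Y Z).inv = (B.c Z (B.tensorObj X Y)).inv ≫ (B.β Z X Y).hom ≫
      B.tensorHom (𝟙 X) (B.c Z Y).hom := by
    rw [← Iso.cancel_iso_hom_left (a X Y Z), Iso.hom_inv_id, ha]
    simp only [Category.assoc]
    rw [Iso.hom_inv_id_assoc, Iso.inv_hom_id_assoc, B.id_tensor_inv_hom]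
  constructor
  · have hd := UBCat.c_hom_comp_c_hom h₁ h₂ Z X Y
    have hb := B.β_c_coherence Y X Z
    rw [ha, ha, ha]
    simp only [Category.assoc]
    rw [reassoc_of% hd, Iso.inv_hom_id_assoc, reassoc_of% B.id_tensor_inv_hom,
      reassoc_of% B.id_tensor_hom_inv, ← B.c_natural, Iso.eq_inv_comp, ← reassoc_of% hb,
      reassoc_of% B.id_tensor_hom_inv, Iso.hom_inv_id_assoc]
  · have hb := B.β_c_coherence Z X Y
    rw [hi, hi, hi]
    simp only [Category.assoc]
    rw [Iso.hom_inv_id_assoc, reassoc_of% B.c_inv_natural, ← reassoc_of% hb]
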